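/- Let w : ℝ → ℝ be any function, let X = (x₁, x₂) ∈ ℝ² with X ≠ 0 and ‖X‖·|w(‖X‖)| < 1, let F_X be the Zermelo–Randers norm with wind W(X) = w(‖X‖)•(−x₂, x₁), and let f : ℝ² → ℝ be f(x) = ‖x‖². If v ≠ 0 is a Finsler gradient of f at X with respect to F_X, then F_X(v) = 2‖X‖; equivalently F_X(v)² = 4·f(X), so f is a Finsler transnormal function for the vortex Randers metric and its level circles f⁻¹(c) are wavefronts. -/

import Mathlib

open RealInnerProductSpace

/-- The point of the Euclidean plane `EuclideanSpace ℝ (Fin 2)` with coordinates `(x, y)`. -/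
noncomputable def vec2 (x y : ℝ) : EuclideanSpace ℝ (Fin 2) :=
  (WithLp.equiv 2 (Fin 2 → ℝ)).symm ![x, y]

/-- The cylindrically symmetric vortex Zermelo wind `W(x₁,x₂) = w(‖x‖)•(−x₂,x₁)`. -/
noncomputable def vortexWind (w : ℝ → ℝ) (x : EuclideanSpace ℝ (Fin 2)) :
    EuclideanSpace ℝ (Fin 2) :=
  w ‖x‖ • vec2 (-(x 1)) (x 0)

/-- The Zermelo–Randers norm with wind `w`:
`F_w(y) = (√(⟪w,y⟫² + λ‖y‖²) − ⟪w,y⟫)/λ` with `λ = 1 − ‖w‖²`.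
(The formula also gives `F_w 0 = 0`.) -/
noncomputable def zermeloRanders (w y : EuclideanSpace ℝ (Fin 2)) : ℝ :=
  (Real.sqrt (⟪w, y⟫ ^ 2 + (1 - ‖w‖ ^ 2) * ‖y‖ ^ 2) - ⟪w, y⟫) / (1 - ‖w‖ ^ 2)

/-- The vortex wind is tangent to the circles centred at the origin. -/
lemma inner_vortexWind_self (w : ℝ → ℝ) (X : EuclideanSpace ℝ (Fin 2)) :
    ⟪X, vortexWind w X⟫ = 0 := by
  simp [vortexWind, vec2, inner_smul_right, PiLp.inner_apply, Fin.sum_univ_two]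
  right
  ring

lemma norm_vortexWind (w : ℝ → ℝ) (X : EuclideanSpace ℝ (Fin 2)) :
    ‖vortexWind w X‖ = ‖X‖ * |w ‖X‖| := by
  rw [vortexWind, norm_smul, Real.norm_eq_abs, mul_comm]
  congr 1
  simp [EuclideanSpace.norm_eq, vec2, Fin.sum_univ_two, add_comm]

lemma zermeloRanders_radicand_pos {W v : EuclideanSpace ℝ (Fin 2)} (hW : ‖W‖ < 1) (hv : v ≠ 0) :
    0 < ⟪W, v⟫ ^ 2 + (1 - ‖W‖ ^ 2) * ‖v‖ ^ 2 := by
  have h1 : 0 < 1 - ‖W‖ ^ 2 := by nlinarith [norm_nonneg W]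
  have h2 : 0 < ‖v‖ := norm_pos_iff.mpr hv
  positivity

lemma zermeloRanders_pos {W v : EuclideanSpace ℝ (Fin 2)} (hW : ‖W‖ < 1) (hv : v ≠ 0) :
    0 < zermeloRanders W v := by
  have h1 : 0 < 1 - ‖W‖ ^ 2 := by nlinarith [norm_nonneg W]
  have h2 : 0 < ‖v‖ := norm_pos_iff.mpr hv
  refine div_pos (sub_pos.mpr (Real.lt_sqrt_of_sq_lt ?_)) h1
  have : 0 < (1 - ‖W‖ ^ 2) * ‖v‖ ^ 2 := by positivity
  linarith

/-- The derivative of the Zermelo–Randers norm along a line. -/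
lemma hasDerivAt_zermeloRanders {W v : EuclideanSpace ℝ (Fin 2)} (hW : ‖W‖ < 1) (hv : v ≠ 0)
    (u : EuclideanSpace ℝ (Fin 2)) :
    HasDerivAt (fun s : ℝ => zermeloRanders W (v + s • u))
      ((⟪v, u⟫ - zermeloRanders W v * ⟪W, u⟫) /
        √(⟪W, v⟫ ^ 2 + (1 - ‖W‖ ^ 2) * ‖v‖ ^ 2)) 0 := by
  have hpos := zermeloRanders_radicand_pos hW hv
  have hlam : 1 - ‖W‖ ^ 2 ≠ 0 := by nlinarith [norm_nonneg W]
  have hline : HasDerivAt (fun s : ℝ => v + s • u) u 0 := by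
    simpa using ((hasDerivAt_id (0 : ℝ)).smul_const u).const_add v
  have hin : HasDerivAt (fun s : ℝ => ⟪W, v + s • u⟫) ⟪W, u⟫ 0 := by
    simpa using (hasDerivAt_const (0 : ℝ) W).inner ℝ hline
  have hsq : HasDerivAt (fun s : ℝ => ‖v + s • u‖ ^ 2) (2 * ⟪v, u⟫) 0 := by
    simpa using hline.norm_sq
  have hrad := ((hin.pow 2).add (hsq.const_mul (1 - ‖W‖ ^ 2))).sqrt (by simpa using hpos.ne')
  refine ((hrad.sub hin).div_const (1 - ‖W‖ ^ 2)).congr_deriv ?_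
  simp only [Pi.add_apply, Pi.pow_apply, zero_smul, add_zero, zermeloRanders]
  have hS := (Real.sqrt_pos.mpr hpos).ne'
  field_simp
  push_cast
  ring

/-- The Zermelo navigation equation satisfied by the Zermelo–Randers norm. -/
lemma zermeloRanders_quadratic {W : EuclideanSpace ℝ (Fin 2)} (hW : ‖W‖ < 1)
    (v : EuclideanSpace ℝ (Fin 2)) :
    (1 - ‖W‖ ^ 2) * zermeloRanders W v ^ 2 + 2 * ⟪W, v⟫ * zermeloRanders W v = ‖v‖ ^ 2 := by
  have h1 : 0 < 1 - ‖W‖ ^ 2 := by nlinarith [norm_nonneg W]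
  have hS := Real.sq_sqrt (show 0 ≤ ⟪W, v⟫ ^ 2 + (1 - ‖W‖ ^ 2) * ‖v‖ ^ 2 by positivity)
  rw [zermeloRanders]
  field_simp
  linear_combination hS

/-- If the differential `2⟪X, ·⟫` is the Legendre transform of `v` with respect to the
Zermelo–Randers norm of a wind orthogonal to `X`, then `v` has norm `2‖X‖`. -/
lemma zermeloRanders_eq_two_mul_norm {W X v : EuclideanSpace ℝ (Fin 2)} (hW : ‖W‖ < 1)
    (hXW : ⟪X, W⟫ = 0) (hv : v ≠ 0)
    (h : ∀ u, 2 * ⟪X, u⟫ =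
      (1 / 2 : ℝ) * deriv (fun s : ℝ => zermeloRanders W (v + s • u) ^ 2) 0) :
    zermeloRanders W v = 2 * ‖X‖ := by
  have hF := zermeloRanders_pos hW hv
  have hS := Real.sqrt_pos.mpr (zermeloRanders_radicand_pos hW hv)
  have hlam : 1 - ‖W‖ ^ 2 ≠ 0 := by nlinarith [norm_nonneg W]
  have hquad := zermeloRanders_quadratic hW v
  have hFS : (1 - ‖W‖ ^ 2) * zermeloRanders W v + ⟪W, v⟫ =
      √(⟪W, v⟫ ^ 2 + (1 - ‖W‖ ^ 2) * ‖v‖ ^ 2) := by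
    rw [zermeloRanders]
    field_simp
    ring
  have key : ∀ u, 2 * ⟪X, u⟫ * √(⟪W, v⟫ ^ 2 + (1 - ‖W‖ ^ 2) * ‖v‖ ^ 2) =
      zermeloRanders W v * (⟪v, u⟫ - zermeloRanders W v * ⟪W, u⟫) := by
    intro u
    rw [h u, ((hasDerivAt_zermeloRanders hW hv u).fun_pow 2).deriv]
    simp only [zero_smul, add_zero]
    field_simp
    push_cast
    ring
  have hkW := key W
  have hkv := key v
  have hkX := key X
  rw [← hFS] at hkW hkv hkX
  rw [hXW, real_inner_self_eq_norm_sq, real_inner_comm W v] at hkW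
  rw [real_inner_self_eq_norm_sq] at hkv
  rw [real_inner_self_eq_norm_sq, real_inner_comm X W, hXW, real_inner_comm X v] at hkX
  generalize zermeloRanders W v = F at *
  have hb : ⟪W, v⟫ = F * ‖W‖ ^ 2 := by
    apply mul_left_cancel₀ hF.ne'
    linarith
  rw [hb] at hkv hkX hquad
  have hX : ⟪X, v⟫ = 2 * ‖X‖ ^ 2 := by
    apply mul_left_cancel₀ hF.ne'
    linear_combination -hkX
  have hsq : F ^ 2 = (2 * ‖X‖) ^ 2 := by
    apply mul_left_cancel₀ hF.ne'
    rw [hX, ← hquad] at hkv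
    linear_combination -hkv
  exact (pow_left_inj₀ hF.le (by positivity) two_ne_zero).mp hsq

/-- For the vortex Randers metric with wind `W(X) = w(‖X‖)•(−x₂,x₁)`,
`‖X‖·|w(‖X‖)| < 1`, and `f(x) = ‖x‖²`: if `v ≠ 0` is a Finsler gradient of `f` at
`X ≠ 0`, then `F_X(v) = 2‖X‖`, equivalently `F_X(v)² = 4·f(X)`; so `f` is a Finsler
transnormal function and its level circles are wavefronts. -/
theorem vortex_radius_squared_transnormal
    (w : ℝ → ℝ) (X : EuclideanSpace ℝ (Fin 2)) (hX : X ≠ 0)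
    (hXw : ‖X‖ * |w ‖X‖| < 1)
    (f : EuclideanSpace ℝ (Fin 2) → ℝ) (hf : ∀ x, f x = ‖x‖ ^ 2)
    (v : EuclideanSpace ℝ (Fin 2)) (hv : v ≠ 0)
    (hFgrad : ∀ u, fderiv ℝ f X u =
      (1 / 2 : ℝ) * deriv (fun s : ℝ => (zermeloRanders (vortexWind w X) (v + s • u)) ^ 2) 0) :
    zermeloRanders (vortexWind w X) v = 2 * ‖X‖ ∧
      (zermeloRanders (vortexWind w X) v) ^ 2 = 4 * f X := by
  have hW : ‖vortexWind w X‖ < 1 := by rwa [norm_vortexWind]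
  have hfd : ∀ u, fderiv ℝ f X u = 2 * ⟪X, u⟫ := by
    intro u
    rw [funext hf, (hasStrictFDerivAt_norm_sq X).hasFDerivAt.fderiv]
    simp
  have hF := zermeloRanders_eq_two_mul_norm hW (inner_vortexWind_self w X) hv
    fun u => (hfd u).symm.trans (hFgrad u)
  refine ⟨hF, ?_⟩
  rw [hF, hf]
  ring
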